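/- Let m ≥ 1000 and 0 < α ≤ π/6. For axisymmetric functions on D_m with the appropriate boundary/mean conditions: (1) if ∫_{π/2-α}^{π/2+α} v_ρ(ρ,φ) sin φ dφ = 0 for all ρ, then ‖v_ρ/ρ‖_{L²(D_m)} ≤ √(2/19)·‖ρ⁻¹∂_φ v_ρ‖_{L²(D_m)}; (2) if v_φ = 0 on the rays φ = π/2 ± α, then ‖v_φ/ρ‖_{L²(D_m)} ≤ (√3/5)·‖ρ⁻¹∂_φ v_φ‖_{L²(D_m)}; (3) if ∫_{D_m} ρ sin φ · v_θ dx = 0, then ‖v_θ/ρ‖_{L²(D_m)} ≤ √5·‖∇v_θ‖_{L²(D_m)}. -/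

import Mathlib

open MeasureTheory Real Set

lemma tan_d (u : ℝ) (h : 0 < cos u) : HasDerivAt tan (1 + tan u ^ 2) u := by
  have := Real.hasDerivAt_tan h.ne'
  convert this using 1
  rw [tan_eq_sin_div_cos]; field_simp; linarith [sin_sq_add_cos_sq u]

lemma dirichlet (a b μ : ℝ) (hab : a ≤ b) (p q z z' g g' : ℝ → ℝ)
    (hp0 : ∀ x ∈ Icc a b, 0 < p x)
    (hp : ∀ x ∈ Icc a b, HasDerivAt p (q x * p x) x)
    (hq : ContinuousOn q (Icc a b))
    (hz : ∀ x ∈ Icc a b, HasDerivAt z (z' x) x)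
    (hz' : ContinuousOn z' (Icc a b))
    (hg : ContinuousOn g (Icc a b)) (hg' : ContinuousOn g' (Icc a b))
    (hd : ∀ x ∈ Ioo a b, HasDerivAt g (g' x) x)
    (ha : g a = 0) (hb : g b = 0)
    (hric : ∀ x ∈ Icc a b, z' x + q x * z x + z x ^ 2 ≤ -μ) :
    μ * (∫ x in a..b, p x * g x ^ 2) ≤ ∫ x in a..b, p x * g' x ^ 2 := by
  have hpc : ContinuousOn p (Icc a b) := fun x hx => (hp x hx).continuousAt.continuousWithinAt
  have hzc : ContinuousOn z (Icc a b) := fun x hx => (hz x hx).continuousAt.continuousWithinAt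
  have hdc : ContinuousOn (fun x => ((q x * p x) * z x + p x * z' x) * g x ^ 2
      + (p x * z x) * (2 * g x * g' x)) (Icc a b) := by fun_prop
  have I : ∀ f : ℝ → ℝ, ContinuousOn f (Icc a b) → IntervalIntegrable f volume a b := by
    intro f hf
    exact ContinuousOn.intervalIntegrable (by rwa [uIcc_of_le hab])
  have h0 : ∫ x in a..b, (((q x * p x) * z x + p x * z' x) * g x ^ 2
      + (p x * z x) * (2 * g x * g' x)) = 0 := by
    rw [intervalIntegral.integral_eq_sub_of_hasDerivAt_of_le (f := fun x => p x * z x * g x ^ 2) hab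
      (by fun_prop) _ (I _ hdc)]
    · simp [ha, hb]
    · intro x hx
      have hx' := Ioo_subset_Icc_self hx
      have := ((hp x hx').mul (hz x hx')).mul ((hd x hx).pow 2)
      exact this.congr_deriv (by simp)
  have h1 : ∫ x in a..b, (μ * (p x * g x ^ 2) + (((q x * p x) * z x + p x * z' x) * g x ^ 2
      + (p x * z x) * (2 * g x * g' x))) ≤ ∫ x in a..b, p x * g' x ^ 2 := by
    apply intervalIntegral.integral_mono_on hab (I _ (by fun_prop)) (I _ (by fun_prop))
    intro x hx
    have h2 := hp0 x hx
    have h3 := hric x hx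
    nlinarith [mul_nonneg h2.le (sq_nonneg (g' x - z x * g x)),
      mul_nonneg (mul_nonneg h2.le (sq_nonneg (g x))) (sub_nonneg.2 h3)]
  rw [intervalIntegral.integral_add (I _ (by fun_prop)) (I _ hdc), h0,
    intervalIntegral.integral_const_mul] at h1
  linarith

lemma neumann (a b μ : ℝ) (hab : a ≤ b) (hμ : 0 < μ) (w q z z' f f' : ℝ → ℝ)
    (hp0 : ∀ x ∈ Icc a b, 0 < w x)
    (hw : Continuous w)
    (hp : ∀ x ∈ Icc a b, HasDerivAt w (-q x * w x) x)
    (hq : ContinuousOn q (Icc a b))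
    (hz : ∀ x ∈ Icc a b, HasDerivAt z (z' x) x)
    (hz' : ContinuousOn z' (Icc a b))
    (hf : Continuous f) (hf' : Continuous f')
    (hd : ∀ x ∈ Ioo a b, HasDerivAt f (f' x) x)
    (h0 : ∫ x in a..b, w x * f x = 0)
    (hric : ∀ x ∈ Icc a b, z' x + q x * z x + z x ^ 2 ≤ -μ) :
    μ * (∫ x in a..b, w x * f x ^ 2) ≤ ∫ x in a..b, w x * f' x ^ 2 := by
  have I : ∀ f : ℝ → ℝ, ContinuousOn f (Icc a b) → IntervalIntegrable f volume a b := by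
    intro f hf
    exact ContinuousOn.intervalIntegrable (by rwa [uIcc_of_le hab])
  have hwf : Continuous (fun x => w x * f x) := by fun_prop
  set g : ℝ → ℝ := fun x => ∫ t in a..x, w t * f t with hgdef
  have hgd : ∀ x, HasDerivAt g (w x * f x) x := fun x =>
    intervalIntegral.integral_hasDerivAt_right (hwf.intervalIntegrable _ _)
      hwf.aestronglyMeasurable.stronglyMeasurableAtFilter hwf.continuousAt
  have hgc : Continuous g := continuous_iff_continuousAt.2 fun x => (hgd x).continuousAt
  have hga : g a = 0 := by simp [hgdef]
  have hgb : g b = 0 := h0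
  have hne : ∀ x ∈ Icc a b, w x ≠ 0 := fun x hx => (hp0 x hx).ne'
  have hwi : ContinuousOn (fun x => (w x)⁻¹) (Icc a b) := hw.continuousOn.inv₀ hne
  have hD := dirichlet a b μ hab (fun x => (w x)⁻¹) q z z' g (fun x => w x * f x)
    (fun x hx => inv_pos.2 (hp0 x hx))
    (fun x hx => by
      have := hne x hx
      exact ((hp x hx).inv this).congr_deriv (by field_simp)) hq hz hz' hgc.continuousOn hwf.continuousOn (fun x _ => hgd x) hga hgb hric
  have e1 : ∫ x in a..b, (w x)⁻¹ * (w x * f x) ^ 2 = ∫ x in a..b, w x * f x ^ 2 := by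
    apply intervalIntegral.integral_congr
    intro x hx
    rw [uIcc_of_le hab] at hx
    have := hne x hx
    simp only
    field_simp
  rw [e1] at hD
  have e2 : ∫ x in a..b, (f' x * g x + f x * (w x * f x)) = 0 := by
    rw [intervalIntegral.integral_eq_sub_of_hasDerivAt_of_le (f := fun x => f x * g x) hab
      (by fun_prop) _ (I _ (by fun_prop))]
    · simp [hga, hgb]
    · intro x hx
      exact (hd x hx).mul (hgd x)
  have h1 : ∫ x in a..b, (2 * μ * (w x * f x ^ 2)) ≤
     ∫ x in a..b, (w x * f' x ^ 2 + μ * (μ * ((w x)⁻¹ * g x ^ 2)) +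
        2 * μ * (f' x * g x + f x * (w x * f x))) := by
    apply intervalIntegral.integral_mono_on hab (I _ (by fun_prop)) (I _ (by fun_prop))
    intro x hx
    have h2 := hp0 x hx
    have h3 : w x * f' x ^ 2 + μ * (μ * ((w x)⁻¹ * g x ^ 2)) + 2 * μ * (f' x * g x)
      = w x * (f' x + μ * (w x)⁻¹ * g x) ^ 2 := by
      field_simp; ring
    have h4 := mul_nonneg h2.le (sq_nonneg (f' x + μ * (w x)⁻¹ * g x))
    nlinarith
  rw [intervalIntegral.integral_add (I _ (by fun_prop)) (I _ (by fun_prop)),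
    intervalIntegral.integral_add (I _ (by fun_prop)) (I _ (by fun_prop))] at h1
  simp only [intervalIntegral.integral_const_mul, e2] at h1
  nlinarith

lemma clampExt (a b c d : ℝ) (hab : a ≤ b) (hcd : c ≤ d) (v : ℝ → ℝ → ℝ)
    (hv : ContinuousOn (fun p : ℝ × ℝ => v p.1 p.2) (Icc a b ×ˢ Icc c d)) :
    ∃ V : ℝ → ℝ → ℝ, Continuous (fun p : ℝ × ℝ => V p.1 p.2) ∧
      ∀ x ∈ Icc a b, ∀ y ∈ Icc c d, V x y = v x y := by
  refine ⟨fun x y => v (projIcc a b hab x) (projIcc c d hcd y), ?_, ?_⟩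
  · have h1 : Continuous (fun p : ℝ × ℝ => (((projIcc a b hab p.1 : ℝ), (projIcc c d hcd p.2 : ℝ)) : ℝ × ℝ)) := by
      have h2 : Continuous (fun x => (projIcc a b hab x : ℝ)) := continuous_subtype_val.comp continuous_projIcc
      have h3 : Continuous (fun x => (projIcc c d hcd x : ℝ)) := continuous_subtype_val.comp continuous_projIcc
      fun_prop
    exact hv.comp_continuous h1 (fun p => ⟨(projIcc a b hab p.1).2, (projIcc c d hcd p.2).2⟩)
  · intro x hx y hy
    simp only [projIcc_of_mem hab hx, projIcc_of_mem hcd hy]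

lemma ang_pos (α : ℝ) (hα' : α ≤ π/6) (x k : ℝ) (hk0 : 0 ≤ k) (hk : k < 3)
    (hx : x ∈ Icc (π/2 - α) (π/2 + α)) : 0 < cos (k * (x - π/2)) := by
  have hpi := Real.pi_pos
  obtain ⟨h1, h2⟩ := hx
  apply cos_pos_of_mem_Ioo
  constructor <;> nlinarith

lemma ang_pos1 (α : ℝ) (hα' : α ≤ π/6) (x : ℝ)
    (hx : x ∈ Icc (π/2 - α) (π/2 + α)) : 0 < cos (x - π/2) := by
  simpa using ang_pos α hα' x 1 (by norm_num) (by norm_num) hx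

lemma ang_sq (α : ℝ) (hα' : α ≤ π/6) (x : ℝ)
    (hx : x ∈ Icc (π/2 - α) (π/2 + α)) : 3 / 4 ≤ cos (x - π/2) ^ 2 := by
  have hpi := Real.pi_pos
  obtain ⟨h1, h2⟩ := hx
  have h : cos (π/6) ≤ cos (|x - π/2|) := by
    apply cos_le_cos_of_nonneg_of_le_pi (abs_nonneg _) (by linarith)
    rw [abs_le]; constructor <;> linarith
  rw [cos_abs, cos_pi_div_six] at h
  have h3 : (√3)^2 = 3 := Real.sq_sqrt (by norm_num)
  nlinarith [Real.sqrt_nonneg 3]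

lemma tanc (k c x : ℝ) (h : 0 < cos (k * (x - c))) :
    HasDerivAt (fun x => tan (k * (x - c))) (k * (1 + tan (k * (x - c)) ^ 2)) x := by
  have h1 : HasDerivAt (fun x => k * (x - c)) k x := by
    simpa using ((hasDerivAt_id x).sub_const c).const_mul k
  have := (tan_d _ h).comp x h1
  exact this.congr_deriv (by ring)

lemma tanc1 (c x : ℝ) (h : 0 < cos (x - c)) :
    HasDerivAt (fun x => tan (x - c)) (1 + tan (x - c) ^ 2) x := by
  simpa using tanc 1 c x (by simpa using h)

lemma cosc (c x : ℝ) (h : 0 < cos (x - c)) :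
    HasDerivAt (fun x => cos (x - c)) (-tan (x - c) * cos (x - c)) x := by
  have h1 : HasDerivAt (fun x => x - c) 1 x := (hasDerivAt_id x).sub_const c
  exact ((hasDerivAt_cos _).comp x h1).congr_deriv (by rw [tan_eq_sin_div_cos]; field_simp)

lemma ang1 (α : ℝ) (hα : 0 < α) (hα' : α ≤ π/6) (f f' : ℝ → ℝ)
    (hf : Continuous f) (hf' : Continuous f')
    (hd : ∀ x ∈ Ioo (π/2 - α) (π/2 + α), HasDerivAt f (f' x) x)
    (h0 : ∫ x in (π/2 - α)..(π/2 + α), sin x * f x = 0) :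
    19 / 2 * (∫ x in (π/2 - α)..(π/2 + α), sin x * f x ^ 2)
      ≤ ∫ x in (π/2 - α)..(π/2 + α), sin x * f' x ^ 2 := by
  simp only [← Real.cos_sub_pi_div_two] at h0 ⊢
  have key : ∀ k ∈ Ioo (0:ℝ) 3, (k ^ 2 + 1 / 2) * (∫ x in (π/2 - α)..(π/2 + α), cos (x - π/2) * f x ^ 2)
      ≤ ∫ x in (π/2 - α)..(π/2 + α), cos (x - π/2) * f' x ^ 2 := by
    intro k hk
    have c1 : ContinuousOn (fun x => tan (x - π/2)) (Icc (π/2 - α) (π/2 + α)) := fun x hx =>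
      (tanc1 _ x (ang_pos1 α hα' x hx)).continuousAt.continuousWithinAt
    have ck : ContinuousOn (fun x => tan (k * (x - π/2))) (Icc (π/2 - α) (π/2 + α)) := fun x hx =>
      (tanc k _ x (ang_pos α hα' x k hk.1.le hk.2 hx)).continuousAt.continuousWithinAt
    refine neumann _ _ _ (by linarith) (by positivity) (fun x => cos (x - π/2)) (fun x => tan (x - π/2))
      (fun x => -(1/2) * tan (x - π/2) - k * tan (k * (x - π/2)))
      (fun x => -(1/2) * (1 + tan (x - π/2) ^ 2) - k * (k * (1 + tan (k * (x - π/2)) ^ 2))) f f'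
      (fun x hx => ang_pos1 α hα' x hx) (by fun_prop) (fun x hx => cosc _ x (ang_pos1 α hα' x hx))
      c1 (fun x hx => ?_) (by fun_prop) hf hf' hd h0 (fun x hx => ?_)
    · exact ((tanc1 _ x (ang_pos1 α hα' x hx)).const_mul _).sub
        ((tanc k _ x (ang_pos α hα' x k hk.1.le hk.2 hx)).const_mul _)
    · nlinarith [sq_nonneg (tan (x - π/2))]
  have hc : Filter.Tendsto (fun k : ℝ => (k ^ 2 + 1 / 2) * (∫ x in (π/2 - α)..(π/2 + α), cos (x - π/2) * f x ^ 2))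
      (nhdsWithin 3 (Iio 3)) (nhds ((3 ^ 2 + 1 / 2) * (∫ x in (π/2 - α)..(π/2 + α), cos (x - π/2) * f x ^ 2))) := by
    apply Filter.Tendsto.mono_left _ nhdsWithin_le_nhds
    apply Continuous.tendsto (by fun_prop)
  have := le_of_tendsto hc (Filter.eventually_of_mem (Ioo_mem_nhdsLT (by norm_num : (0:ℝ) < 3)) key)
  norm_num at this ⊢
  exact this

lemma ang2 (α : ℝ) (hα : 0 < α) (hα' : α ≤ π/6) (f f' : ℝ → ℝ)
    (hf : Continuous f) (hf' : Continuous f')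
    (hd : ∀ x ∈ Ioo (π/2 - α) (π/2 + α), HasDerivAt f (f' x) x)
    (ha : f (π/2 - α) = 0) (hb : f (π/2 + α) = 0) :
    25 / 3 * (∫ x in (π/2 - α)..(π/2 + α), sin x * f x ^ 2)
      ≤ ∫ x in (π/2 - α)..(π/2 + α), sin x * f' x ^ 2 := by
  simp only [← Real.cos_sub_pi_div_two]
  obtain ⟨k, hkd⟩ : ∃ k : ℝ, k = 2.99 := ⟨_, rfl⟩
  have hk : k ∈ Ioo (0:ℝ) 3 := by rw [hkd]; norm_num
  have c1 : ContinuousOn (fun x => tan (x - π/2)) (Icc (π/2 - α) (π/2 + α)) := fun x hx =>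
    (tanc1 _ x (ang_pos1 α hα' x hx)).continuousAt.continuousWithinAt
  have ck : ContinuousOn (fun x => tan (k * (x - π/2))) (Icc (π/2 - α) (π/2 + α)) := fun x hx =>
    (tanc k _ x (ang_pos α hα' x k hk.1.le hk.2 hx)).continuousAt.continuousWithinAt
  refine dirichlet _ _ _ (by linarith) (fun x => cos (x - π/2)) (fun x => -tan (x - π/2))
    (fun x => (1/2) * tan (x - π/2) - k * tan (k * (x - π/2)))
    (fun x => (1/2) * (1 + tan (x - π/2) ^ 2) - k * (k * (1 + tan (k * (x - π/2)) ^ 2))) f f'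
    (fun x hx => ang_pos1 α hα' x hx) (fun x hx => cosc _ x (ang_pos1 α hα' x hx))
    (by fun_prop) (fun x hx => ?_) (by fun_prop) hf.continuousOn hf'.continuousOn hd ha hb (fun x hx => ?_)
  · exact ((tanc1 _ x (ang_pos1 α hα' x hx)).const_mul _).sub
      ((tanc k _ x (ang_pos α hα' x k hk.1.le hk.2 hx)).const_mul _)
  · have h1 := ang_sq α hα' x hx
    have h2 := Real.one_add_tan_sq_mul_cos_sq_eq_one (ang_pos1 α hα' x hx).ne'
    have h3 : tan (x - π/2) ^ 2 ≤ 1 / 3 := by nlinarith [sq_nonneg (tan (x - π/2))]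
    have h4 : k ^ 2 = 8.9401 := by rw [hkd]; norm_num
    ring_nf
    ring_nf at h3
    rw [h4]
    linarith

lemma ang3 (α : ℝ) (hα : 0 < α) (hα' : α ≤ π/6) (f f' : ℝ → ℝ)
    (hf : Continuous f) (hf' : Continuous f')
    (hd : ∀ x ∈ Ioo (π/2 - α) (π/2 + α), HasDerivAt f (f' x) x)
    (h0 : ∫ x in (π/2 - α)..(π/2 + α), sin x ^ 2 * f x = 0) :
    1.72 * (∫ x in (π/2 - α)..(π/2 + α), sin x * f x ^ 2)
      ≤ ∫ x in (π/2 - α)..(π/2 + α), sin x * f' x ^ 2 := by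
  simp only [← Real.cos_sub_pi_div_two] at h0 ⊢
  have c1 : ContinuousOn (fun x => tan (x - π/2)) (Icc (π/2 - α) (π/2 + α)) := fun x hx =>
    (tanc1 _ x (ang_pos1 α hα' x hx)).continuousAt.continuousWithinAt
  have h1 := neumann _ _ 2 (by linarith) (by norm_num) (fun x => cos (x - π/2) ^ 2) (fun x => 2 * tan (x - π/2))
      (fun x => -2 * tan (x - π/2))
      (fun x => -2 * (1 + tan (x - π/2) ^ 2)) f f'
      (fun x hx => pow_pos (ang_pos1 α hα' x hx) 2) (by fun_prop)
      (fun x hx => ((cosc _ x (ang_pos1 α hα' x hx)).pow 2).congr_deriv (by simp; ring))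
      (by fun_prop) (fun x hx => (tanc1 _ x (ang_pos1 α hα' x hx)).const_mul _) (by fun_prop) hf hf' hd h0
      (fun x hx => by nlinarith [sq_nonneg (tan (x - π/2))])
  have h2 : ∫ x in (π/2 - α)..(π/2 + α), 0.86 * (cos (x - π/2) * f x ^ 2) ≤
      ∫ x in (π/2 - α)..(π/2 + α), cos (x - π/2) ^ 2 * f x ^ 2 := by
    apply intervalIntegral.integral_mono_on (by linarith) (Continuous.intervalIntegrable (by fun_prop) _ _)
      (Continuous.intervalIntegrable (by fun_prop) _ _)
    intro x hx
    have h3 := ang_sq α hα' x hx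
    have h4 := ang_pos1 α hα' x hx
    have h5 : 0.86 ≤ cos (x - π/2) := by
      by_contra h
      push Not at h
      nlinarith
    nlinarith [mul_nonneg (mul_nonneg h4.le (sub_nonneg.2 h5)) (sq_nonneg (f x))]
  have h6 : ∫ x in (π/2 - α)..(π/2 + α), cos (x - π/2) ^ 2 * f' x ^ 2 ≤
      ∫ x in (π/2 - α)..(π/2 + α), cos (x - π/2) * f' x ^ 2 := by
    apply intervalIntegral.integral_mono_on (by linarith) (Continuous.intervalIntegrable (by fun_prop) _ _)
      (Continuous.intervalIntegrable (by fun_prop) _ _)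
    intro x hx
    have h4 := ang_pos1 α hα' x hx
    nlinarith [mul_nonneg (mul_nonneg h4.le (sub_nonneg.2 (cos_le_one (x - π/2)))) (sq_nonneg (f' x))]
  rw [intervalIntegral.integral_const_mul] at h2
  linarith

lemma int6 (ε : ℝ) (h : 0 < ε) : ∫ r in ε..1, r ^ 6 ≤ 1 / 7 := by
  rw [integral_pow]
  have := pow_pos h 7
  norm_num
  linarith

lemma hardy1 (ε : ℝ) (h : 0 < ε) (h' : ε ≤ 1/1000) (v v' : ℝ → ℝ)
    (hv : Continuous v) (hv' : Continuous v')
    (hd : ∀ x ∈ Ioo ε 1, HasDerivAt v (v' x) x) :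
    ∫ r in ε..1, v r ^ 2 ≤ 5 * (∫ r in ε..1, r ^ 2 * v' r ^ 2)
      + 3.03 * (∫ r in ε..1, 4 * r ^ 3 * v r) ^ 2 := by
  have hε : ε ≤ 1 := by linarith
  have I : ∀ f : ℝ → ℝ, Continuous f → IntervalIntegrable f volume ε 1 := 
    fun f hf => hf.intervalIntegrable _ _
  have e1 : ∫ r in ε..1, (1 * v r ^ 2 + r * (2 * v r * v' r)) = v 1 ^ 2 - ε * v ε ^ 2 := by
    rw [intervalIntegral.integral_eq_sub_of_hasDerivAt_of_le (f := fun x => x * v x ^ 2) hε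
      (by fun_prop) _ (I _ (by fun_prop))]
    · simp
    · intro x hx
      exact ((hasDerivAt_id x).mul ((hd x hx).pow 2)).congr_deriv (by simp)
  have e2 : ∫ r in ε..1, (4 * r ^ 3 * v r + (r ^ 4 - ε ^ 4) * v' r) = (1 - ε ^ 4) * v 1 := by
    rw [intervalIntegral.integral_eq_sub_of_hasDerivAt_of_le (f := fun x => (x ^ 4 - ε ^ 4) * v x) hε
      (by fun_prop) _ (I _ (by fun_prop))]
    · simp
    · intro x hx
      exact ((((hasDerivAt_id x).pow 4).sub_const (ε ^ 4)).mul (hd x hx)).congr_deriv (by simp)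
  rw [intervalIntegral.integral_add (I _ (by fun_prop)) (I _ (by fun_prop))] at e2
  have h1 : ∫ r in ε..1, 1 / 2 * v r ^ 2 ≤
      ∫ r in ε..1, ((1 * v r ^ 2 + r * (2 * v r * v' r)) + 2 * (r ^ 2 * v' r ^ 2)) := by
    apply intervalIntegral.integral_mono_on hε (I _ (by fun_prop)) (I _ (by fun_prop))
    intro x hx
    nlinarith [sq_nonneg (v x + 2 * x * v' x)]
  rw [intervalIntegral.integral_add (I _ (by fun_prop)) (I _ (by fun_prop)), e1,
    intervalIntegral.integral_const_mul, intervalIntegral.integral_const_mul] at h1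
  set M := ∫ r in ε..1, 4 * r ^ 3 * v r
  set G := ∫ r in ε..1, r ^ 2 * v' r ^ 2
  set A := ∫ r in ε..1, v r ^ 2
  set R := ∫ r in ε..1, (r ^ 4 - ε ^ 4) * v' r with hR
  have h2 : ∀ s : ℝ, 2 * s * R ≤ s ^ 2 * (1 / 7) + G := by
    intro s
    have : ∫ r in ε..1, 2 * s * ((r ^ 4 - ε ^ 4) * v' r) ≤
      ∫ r in ε..1, (s ^ 2 * r ^ 6 + r ^ 2 * v' r ^ 2) := by
      apply intervalIntegral.integral_mono_on hε (I _ (by fun_prop)) (I _ (by fun_prop))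
      intro x hx
      have hx0 : 0 < x := lt_of_lt_of_le h hx.1
      have h4 : ε ^ 4 ≤ x ^ 4 := pow_le_pow_left₀ h.le hx.1 4
      obtain ⟨y, hy⟩ : ∃ y, y = (x ^ 4 - ε ^ 4) / x := ⟨_, rfl⟩
      have hy1 : x ^ 4 - ε ^ 4 = y * x := by rw [hy]; field_simp
      have hy0 : 0 ≤ y := by rw [hy]; exact div_nonneg (by linarith) hx0.le
      have hy2 : y ≤ x ^ 3 := by
        rw [hy, div_le_iff₀ hx0]; nlinarith [pow_pos h 4]
      have hy3 : y ^ 2 ≤ x ^ 6 := by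
        calc y ^ 2 ≤ (x ^ 3) ^ 2 := pow_le_pow_left₀ hy0 hy2 2
          _ = _ := by ring
      rw [hy1]
      nlinarith [sq_nonneg (s * y - x * v' x), mul_nonneg (sq_nonneg s) (sub_nonneg.2 hy3)]
    rw [intervalIntegral.integral_add (I _ (by fun_prop)) (I _ (by fun_prop)),
      intervalIntegral.integral_const_mul, intervalIntegral.integral_const_mul] at this
    nlinarith [mul_le_mul_of_nonneg_left (int6 ε h) (sq_nonneg s)]
  have h3 := h2 (7 * R)
  have h4 : ε ^ 4 ≤ 1 / 1000 := by
    calc ε ^ 4 ≤ ε ^ 1 := pow_le_pow_of_le_one h.le hε (by norm_num)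
      _ ≤ _ := by simpa using h'
  have h5 : v 1 ^ 2 ≤ 1.01 * ((1 - ε ^ 4) * v 1) ^ 2 := by
    have : 1 ≤ 1.01 * (1 - ε ^ 4) ^ 2 := by nlinarith
    nlinarith [mul_le_mul_of_nonneg_right this (sq_nonneg (v 1))]
  rw [← e2] at h5
  have h6 : (M + R) ^ 2 ≤ 1.5 * M ^ 2 + 3 * R ^ 2 := by nlinarith [sq_nonneg (M - 2 * R)]
  have h7 : 0 ≤ ε * v ε ^ 2 := by positivity
  nlinarith [sq_nonneg R]

lemma swapc (F : ℝ → ℝ → ℝ) (hF : Continuous (fun p : ℝ × ℝ => F p.1 p.2)) (a b c d : ℝ) :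
    ∫ x in a..b, ∫ y in c..d, F x y = ∫ y in c..d, ∫ x in a..b, F x y := by
  apply MeasureTheory.intervalIntegral_intervalIntegral_swap
  have : IntegrableOn (fun p : ℝ × ℝ => F p.1 p.2) (uIcc a b ×ˢ uIcc c d) (volume.prod volume) :=
    hF.continuousOn.integrableOn_compact (isCompact_uIcc.prod isCompact_uIcc)
  exact this.mono_set (prod_mono uIoc_subset_uIcc uIoc_subset_uIcc)

lemma hardy3 (ε α : ℝ) (h : 0 < ε) (h' : ε ≤ 1/1000) (hα : 0 < α) (hα' : α ≤ π/6)
    (V Vr Vp : ℝ → ℝ → ℝ)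
    (hV : Continuous (fun p : ℝ × ℝ => V p.1 p.2))
    (hVr : Continuous (fun p : ℝ × ℝ => Vr p.1 p.2))
    (hVp : Continuous (fun p : ℝ × ℝ => Vp p.1 p.2))
    (hdr : ∀ x ∈ Ioo ε 1, ∀ y ∈ Icc (π/2 - α) (π/2 + α), HasDerivAt (fun s => V s y) (Vr x y) x)
    (hdp : ∀ x ∈ Icc ε 1, ∀ y ∈ Ioo (π/2 - α) (π/2 + α), HasDerivAt (fun s => V x s) (Vp x y) y)
    (h0 : ∫ x in ε..1, ∫ y in (π/2 - α)..(π/2 + α), sin y ^ 2 * (4 * x ^ 3 * V x y) = 0) :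
    ∫ x in ε..1, ∫ y in (π/2 - α)..(π/2 + α), sin y * V x y ^ 2 ≤
    5 * ∫ x in ε..1, ∫ y in (π/2 - α)..(π/2 + α), sin y * (x ^ 2 * Vr x y ^ 2 + Vp x y ^ 2) := by
  have hε : ε ≤ 1 := by linarith
  have hab : π/2 - α ≤ π/2 + α := by linarith
  have V1 : ∀ y, Continuous (fun x => V x y) := fun y => hV.comp (by fun_prop : Continuous fun x : ℝ => (x, y))
  have Vr1 : ∀ y, Continuous (fun x => Vr x y) := fun y => hVr.comp (by fun_prop : Continuous fun x : ℝ => (x, y))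
  have Vp1 : ∀ y, Continuous (fun x => Vp x y) := fun y => hVp.comp (by fun_prop : Continuous fun x : ℝ => (x, y))
  have V2 : Continuous (fun p : ℝ × ℝ => V p.2 p.1) := hV.comp continuous_swap
  have Vr2 : Continuous (fun p : ℝ × ℝ => Vr p.2 p.1) := hVr.comp continuous_swap
  have Vp2 : Continuous (fun p : ℝ × ℝ => Vp p.2 p.1) := hVp.comp continuous_swap
  have P : ∀ F : ℝ → ℝ → ℝ, Continuous (fun p : ℝ × ℝ => F p.1 p.2) →
      Continuous (fun y => ∫ x in ε..1, F y x) := fun F hF =>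
    intervalIntegral.continuous_parametric_intervalIntegral_of_continuous' hF ε 1
  rw [swapc _ (by fun_prop)] at h0 ⊢
  rw [swapc (fun x y => sin y * (x ^ 2 * Vr x y ^ 2 + Vp x y ^ 2)) (by fun_prop)]
  simp only [intervalIntegral.integral_const_mul] at h0 ⊢
  have IA : Continuous (fun y => ∫ x in ε..1, V x y ^ 2) := P (fun y x => V x y ^ 2) (by fun_prop)
  have IG : Continuous (fun y => ∫ x in ε..1, x ^ 2 * Vr x y ^ 2) :=
    P (fun y x => x ^ 2 * Vr x y ^ 2) (by fun_prop)
  have IP : Continuous (fun y => ∫ x in ε..1, Vp x y ^ 2) := P (fun y x => Vp x y ^ 2) (by fun_prop)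
  have IM : Continuous (fun y => ∫ x in ε..1, 4 * x ^ 3 * V x y) :=
    P (fun y x => 4 * x ^ 3 * V x y) (by fun_prop)
  have IN : Continuous (fun y => ∫ x in ε..1, 4 * x ^ 3 * Vp x y) :=
    P (fun y x => 4 * x ^ 3 * Vp x y) (by fun_prop)
  have hMd : ∀ y ∈ Ioo (π/2 - α) (π/2 + α), HasDerivAt (fun y => ∫ x in ε..1, 4 * x ^ 3 * V x y)
      (∫ x in ε..1, 4 * x ^ 3 * Vp x y) y := by
    intro y hy
    have hcc : Continuous (fun p : ℝ × ℝ => 4 * p.1 ^ 3 * Vp p.1 p.2) := by fun_prop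
    obtain ⟨C, hC⟩ := (isCompact_Icc (a := ε) (b := 1)).prod
      (isCompact_Icc (a := π/2 - α) (b := π/2 + α)) |>.exists_bound_of_continuousOn hcc.continuousOn
    refine (intervalIntegral.hasDerivAt_integral_of_dominated_loc_of_deriv_le (𝕜 := ℝ)
      (F := fun y x => 4 * x ^ 3 * V x y) (F' := fun y x => 4 * x ^ 3 * Vp x y) (bound := fun _ => C)
      (s := Ioo (π/2 - α) (π/2 + α)) (Ioo_mem_nhds hy.1 hy.2) ?_ ?_ ?_ ?_ ?_ ?_).2
    · refine Filter.Eventually.of_forall fun z => ?_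
      have := V1 z
      exact Continuous.aestronglyMeasurable (by fun_prop)
    · have := V1 y
      exact Continuous.intervalIntegrable (by fun_prop) _ _
    · have := Vp1 y
      exact Continuous.aestronglyMeasurable (by fun_prop)
    · refine Filter.Eventually.of_forall fun t ht z hz => ?_
      rw [uIoc_of_le hε] at ht
      exact hC (t, z) ⟨Ioc_subset_Icc_self ht, Ioo_subset_Icc_self hz⟩
    · exact intervalIntegrable_const
    · refine Filter.Eventually.of_forall fun t ht z hz => ?_
      rw [uIoc_of_le hε] at ht
      exact (hdp t (Ioc_subset_Icc_self ht) z hz).const_mul _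
  have hPo := ang3 α hα hα' _ _ IM IN hMd h0
  have hN : ∀ y, 7 / 16 * (∫ x in ε..1, 4 * x ^ 3 * Vp x y) ^ 2 ≤ ∫ x in ε..1, Vp x y ^ 2 := by
    intro y
    have c1 := Vp1 y
    have I : ∀ f : ℝ → ℝ, Continuous f → IntervalIntegrable f volume ε 1 := 
      fun f hf => hf.intervalIntegrable _ _
    set N := ∫ x in ε..1, 4 * x ^ 3 * Vp x y with hNdef
    have : ∫ x in ε..1, 2 * (7 / 16 * N) * (4 * x ^ 3 * Vp x y) ≤
        ∫ x in ε..1, (16 * (7 / 16 * N) ^ 2 * x ^ 6 + Vp x y ^ 2) := by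
      apply intervalIntegral.integral_mono_on hε (I _ (by fun_prop)) (I _ (by fun_prop))
      intro x hx
      nlinarith [sq_nonneg (4 * (7 / 16 * N) * x ^ 3 - Vp x y)]
    rw [intervalIntegral.integral_add (I _ (by fun_prop)) (I _ (by fun_prop)),
      intervalIntegral.integral_const_mul, intervalIntegral.integral_const_mul, ← hNdef] at this
    nlinarith [mul_le_mul_of_nonneg_left (int6 ε h) (sq_nonneg N)]
  have J : ∀ f : ℝ → ℝ, Continuous f → IntervalIntegrable f volume (π/2 - α) (π/2 + α) := 
    fun f hf => hf.intervalIntegrable _ _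
  have hs : ∀ y ∈ Icc (π/2 - α) (π/2 + α), 0 ≤ sin y := fun y hy => by
    rw [← Real.cos_sub_pi_div_two]; exact (ang_pos1 α hα' y hy).le
  have hN2 : ∫ y in (π/2 - α)..(π/2 + α), 7 / 16 * (sin y * (∫ x in ε..1, 4 * x ^ 3 * Vp x y) ^ 2) ≤
      ∫ y in (π/2 - α)..(π/2 + α), sin y * ∫ x in ε..1, Vp x y ^ 2 := by
    apply intervalIntegral.integral_mono_on hab (J _ (by fun_prop)) (J _ (by fun_prop))
    intro y hy
    nlinarith [mul_le_mul_of_nonneg_left (hN y) (hs y hy)]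
  have hH : ∫ y in (π/2 - α)..(π/2 + α), sin y * ∫ x in ε..1, V x y ^ 2 ≤
      ∫ y in (π/2 - α)..(π/2 + α), (5 * (sin y * ∫ x in ε..1, x ^ 2 * Vr x y ^ 2)
        + 3.03 * (sin y * (∫ x in ε..1, 4 * x ^ 3 * V x y) ^ 2)) := by
    apply intervalIntegral.integral_mono_on hab (J _ (by fun_prop)) (J _ (by fun_prop))
    intro y hy
    have := hardy1 ε h h' (fun x => V x y) (fun x => Vr x y) (V1 y) (Vr1 y) (fun x hx => hdr x hx y hy)
    nlinarith [mul_le_mul_of_nonneg_left this (hs y hy)]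
  rw [intervalIntegral.integral_add (J _ (by fun_prop)) (J _ (by fun_prop)),
    intervalIntegral.integral_const_mul, intervalIntegral.integral_const_mul] at hH
  rw [intervalIntegral.integral_const_mul] at hN2
  have hE : ∫ y in (π/2 - α)..(π/2 + α), sin y * (∫ x in ε..1, (x ^ 2 * Vr x y ^ 2 + Vp x y ^ 2))
      = (∫ y in (π/2 - α)..(π/2 + α), sin y * ∫ x in ε..1, x ^ 2 * Vr x y ^ 2)
       + ∫ y in (π/2 - α)..(π/2 + α), sin y * ∫ x in ε..1, Vp x y ^ 2 := by
    rw [← intervalIntegral.integral_add (J _ (by fun_prop)) (J _ (by fun_prop))]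
    congr 1
    ext y
    have c1 := Vp1 y
    have c2 := Vr1 y
    rw [intervalIntegral.integral_add (Continuous.intervalIntegrable (by fun_prop) _ _)
      (Continuous.intervalIntegrable (by fun_prop) _ _)]
    ring
  rw [hE]
  have hpos : 0 ≤ ∫ y in (π/2 - α)..(π/2 + α), sin y * ∫ x in ε..1, Vp x y ^ 2 := by
    apply intervalIntegral.integral_nonneg hab
    intro y hy
    exact mul_nonneg (hs y hy) (intervalIntegral.integral_nonneg hε fun x _ => sq_nonneg _)
  linarith

lemma dcong (ε a b : ℝ) (hε : ε ≤ 1) (hab : a ≤ b) (F H : ℝ → ℝ → ℝ)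
    (h : ∀ x ∈ Icc ε 1, ∀ y ∈ Icc a b, F x y = 2 * π * H x y) :
    ∫ x in ε..1, ∫ y in a..b, F x y = 2 * π * ∫ x in ε..1, ∫ y in a..b, H x y := by
  rw [← intervalIntegral.integral_const_mul]
  apply intervalIntegral.integral_congr
  intro x hx
  rw [uIcc_of_le hε] at hx
  simp only
  rw [← intervalIntegral.integral_const_mul]
  apply intervalIntegral.integral_congr
  intro y hy
  rw [uIcc_of_le hab] at hy
  exact h x hx y hy

lemma liftr (ε a b C : ℝ) (hε : ε ≤ 1) (V W : ℝ → ℝ → ℝ)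
    (hV : Continuous (fun p : ℝ × ℝ => V p.1 p.2))
    (hW : Continuous (fun p : ℝ × ℝ => W p.1 p.2))
    (h : ∀ x ∈ Icc ε 1, C * (∫ y in a..b, sin y * V x y ^ 2) ≤ ∫ y in a..b, sin y * W x y ^ 2) :
    C * (∫ x in ε..1, ∫ y in a..b, sin y * V x y ^ 2) ≤
      ∫ x in ε..1, ∫ y in a..b, sin y * W x y ^ 2 := by
  have P : ∀ F : ℝ → ℝ → ℝ, Continuous (fun p : ℝ × ℝ => F p.1 p.2) →
      Continuous (fun x => ∫ y in a..b, F x y) := fun F hF =>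
    intervalIntegral.continuous_parametric_intervalIntegral_of_continuous' hF a b
  have h1 := P (fun x y => sin y * V x y ^ 2) (by fun_prop)
  have h2 := P (fun x y => sin y * W x y ^ 2) (by fun_prop)
  rw [← intervalIntegral.integral_const_mul]
  exact intervalIntegral.integral_mono_on hε (Continuous.intervalIntegrable (by fun_prop) _ _)
    (h2.intervalIntegrable _ _) h

lemma derivExt (a b : ℝ) (f g : ℝ → ℝ) (d x : ℝ) (hx : x ∈ Ioo a b)
    (hfg : ∀ y ∈ Icc a b, g y = f y) (h : HasDerivAt f d x) : HasDerivAt g d x := by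
  apply h.congr_of_eventuallyEq
  filter_upwards [Ioo_mem_nhds hx.1 hx.2] with y hy
  exact hfg y (Ioo_subset_Icc_self hy)

/-- Weighted Poincaré/Hardy estimates for the three velocity components on
`D_m = {1/m < ρ < 1, π/2-α < φ < π/2+α}` (`dx = 2πρ² sin φ dρ dφ`):
(1) `‖v_ρ/ρ‖² ≤ (2/19)‖ρ⁻¹∂_φ v_ρ‖²` when the weighted angular mean of `v_ρ` vanishes;
(2) `‖v_φ/ρ‖² ≤ (3/25)‖ρ⁻¹∂_φ v_φ‖²` when `v_φ` vanishes on the rays;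
(3) `‖v_θ/ρ‖² ≤ 5‖∇v_θ‖²` when `∫ ρ sin φ · v_θ dx = 0`. -/
theorem velocity_component_estimates (m : ℕ) (hm : 1000 ≤ m)
    (α : ℝ) (hα : 0 < α) (hα' : α ≤ π/6)
    (vr vrp vf vfp vt vtr vtp : ℝ → ℝ → ℝ)
    (hcvr : ContinuousOn (fun p : ℝ × ℝ => vr p.1 p.2)
      (Set.Icc (1/(m:ℝ)) 1 ×ˢ Set.Icc (π/2 - α) (π/2 + α)))
    (hcvrp : ContinuousOn (fun p : ℝ × ℝ => vrp p.1 p.2)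
      (Set.Icc (1/(m:ℝ)) 1 ×ˢ Set.Icc (π/2 - α) (π/2 + α)))
    (hcvf : ContinuousOn (fun p : ℝ × ℝ => vf p.1 p.2)
      (Set.Icc (1/(m:ℝ)) 1 ×ˢ Set.Icc (π/2 - α) (π/2 + α)))
    (hcvfp : ContinuousOn (fun p : ℝ × ℝ => vfp p.1 p.2)
      (Set.Icc (1/(m:ℝ)) 1 ×ˢ Set.Icc (π/2 - α) (π/2 + α)))
    (hcvt : ContinuousOn (fun p : ℝ × ℝ => vt p.1 p.2)
      (Set.Icc (1/(m:ℝ)) 1 ×ˢ Set.Icc (π/2 - α) (π/2 + α)))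
    (hcvtr : ContinuousOn (fun p : ℝ × ℝ => vtr p.1 p.2)
      (Set.Icc (1/(m:ℝ)) 1 ×ˢ Set.Icc (π/2 - α) (π/2 + α)))
    (hcvtp : ContinuousOn (fun p : ℝ × ℝ => vtp p.1 p.2)
      (Set.Icc (1/(m:ℝ)) 1 ×ˢ Set.Icc (π/2 - α) (π/2 + α)))
    (hdvr : ∀ ρ ∈ Set.Icc (1/(m:ℝ)) 1, ∀ φ ∈ Set.Icc (π/2 - α) (π/2 + α),
      HasDerivAt (fun t => vr ρ t) (vrp ρ φ) φ)
    (hdvf : ∀ ρ ∈ Set.Icc (1/(m:ℝ)) 1, ∀ φ ∈ Set.Icc (π/2 - α) (π/2 + α),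
      HasDerivAt (fun t => vf ρ t) (vfp ρ φ) φ)
    (hdvtr : ∀ ρ ∈ Set.Icc (1/(m:ℝ)) 1, ∀ φ ∈ Set.Icc (π/2 - α) (π/2 + α),
      HasDerivAt (fun s => vt s φ) (vtr ρ φ) ρ)
    (hdvtp : ∀ ρ ∈ Set.Icc (1/(m:ℝ)) 1, ∀ φ ∈ Set.Icc (π/2 - α) (π/2 + α),
      HasDerivAt (fun t => vt ρ t) (vtp ρ φ) φ)
    -- (1) weighted angular mean of v_ρ vanishes for every ρ
    (hmr : ∀ ρ ∈ Set.Icc (1/(m:ℝ)) 1,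
      (∫ φ in (π/2 - α)..(π/2 + α), vr ρ φ * Real.sin φ) = 0)
    -- (2) v_φ vanishes on the rays
    (hbf : ∀ ρ ∈ Set.Icc (1/(m:ℝ)) 1, vf ρ (π/2 - α) = 0 ∧ vf ρ (π/2 + α) = 0)
    -- (3) vanishing azimuthal angular momentum for v_θ
    (hmt : (∫ ρ in (1/(m:ℝ))..1, ∫ φ in (π/2 - α)..(π/2 + α),
        (ρ * Real.sin φ * vt ρ φ) * (2*π*ρ^2*Real.sin φ)) = 0) :
    ((∫ ρ in (1/(m:ℝ))..1, ∫ φ in (π/2 - α)..(π/2 + α),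
        (vr ρ φ / ρ) ^ 2 * (2*π*ρ^2*Real.sin φ))
      ≤ (2/19) * ∫ ρ in (1/(m:ℝ))..1, ∫ φ in (π/2 - α)..(π/2 + α),
          (vrp ρ φ / ρ) ^ 2 * (2*π*ρ^2*Real.sin φ))
    ∧
    ((∫ ρ in (1/(m:ℝ))..1, ∫ φ in (π/2 - α)..(π/2 + α),
        (vf ρ φ / ρ) ^ 2 * (2*π*ρ^2*Real.sin φ))
      ≤ (3/25) * ∫ ρ in (1/(m:ℝ))..1, ∫ φ in (π/2 - α)..(π/2 + α),
          (vfp ρ φ / ρ) ^ 2 * (2*π*ρ^2*Real.sin φ))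
    ∧
    ((∫ ρ in (1/(m:ℝ))..1, ∫ φ in (π/2 - α)..(π/2 + α),
        (vt ρ φ / ρ) ^ 2 * (2*π*ρ^2*Real.sin φ))
      ≤ 5 * ∫ ρ in (1/(m:ℝ))..1, ∫ φ in (π/2 - α)..(π/2 + α),
          (vtr ρ φ ^ 2 + (vtp ρ φ / ρ) ^ 2) * (2*π*ρ^2*Real.sin φ)) := by
  have hpi := Real.pi_pos
  have hm0 : (1000:ℝ) ≤ m := by exact_mod_cast hm
  obtain ⟨ε, hεd⟩ : ∃ ε : ℝ, ε = 1 / (m:ℝ) := ⟨_, rfl⟩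
  have hε0 : 0 < ε := by rw [hεd]; positivity
  have hε' : ε ≤ 1 / 1000 := by
    rw [hεd]; exact one_div_le_one_div_of_le (by norm_num) hm0
  rw [← hεd] at hcvr hcvrp hcvf hcvfp hcvt hcvtr hcvtp hdvr hdvf hdvtr hdvtp hmr hbf hmt ⊢
  have hε : ε ≤ 1 := by linarith
  have hab : π/2 - α ≤ π/2 + α := by linarith
  obtain ⟨Vr, cVr, eVr⟩ := clampExt _ _ _ _ hε hab vr hcvr
  obtain ⟨Vrp, cVrp, eVrp⟩ := clampExt _ _ _ _ hε hab vrp hcvrp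
  obtain ⟨Vf, cVf, eVf⟩ := clampExt _ _ _ _ hε hab vf hcvf
  obtain ⟨Vfp, cVfp, eVfp⟩ := clampExt _ _ _ _ hε hab vfp hcvfp
  obtain ⟨Vt, cVt, eVt⟩ := clampExt _ _ _ _ hε hab vt hcvt
  obtain ⟨Vtr, cVtr, eVtr⟩ := clampExt _ _ _ _ hε hab vtr hcvtr
  obtain ⟨Vtp, cVtp, eVtp⟩ := clampExt _ _ _ _ hε hab vtp hcvtp
  have S : ∀ V : ℝ → ℝ → ℝ, Continuous (fun p : ℝ × ℝ => V p.1 p.2) → ∀ x, Continuous (V x) :=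
    fun V hV x => hV.comp (by fun_prop : Continuous fun y : ℝ => (x, y))
  have T : ∀ v V : ℝ → ℝ → ℝ, (∀ x ∈ Icc ε 1, ∀ y ∈ Icc (π/2 - α) (π/2 + α), V x y = v x y) →
      (∫ ρ in ε..1, ∫ φ in (π/2 - α)..(π/2 + α), (v ρ φ / ρ) ^ 2 * (2*π*ρ^2*Real.sin φ))
      = 2 * π * ∫ ρ in ε..1, ∫ φ in (π/2 - α)..(π/2 + α), sin φ * V ρ φ ^ 2 := by
    intro v V hvV
    apply dcong _ _ _ hε hab
    intro x hx y hy
    have hx0 : 0 < x := lt_of_lt_of_le hε0 hx.1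
    rw [hvV x hx y hy]
    field_simp
  refine ⟨?_, ?_, ?_⟩
  · rw [T _ _ eVr, T _ _ eVrp]
    have := liftr ε (π/2 - α) (π/2 + α) (19/2) hε Vr Vrp cVr cVrp (fun x hx => by
      refine ang1 α hα hα' _ _ (S _ cVr x) (S _ cVrp x) (fun y hy => ?_) ?_
      · have hy' := Ioo_subset_Icc_self hy
        rw [eVrp x hx y hy']
        exact derivExt _ _ _ _ _ _ hy (eVr x hx) (hdvr x hx y hy')
      · rw [← hmr x hx]
        apply intervalIntegral.integral_congr
        intro y hy
        rw [uIcc_of_le hab] at hy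
        simp only
        rw [eVr x hx y hy, mul_comm])
    nlinarith
  · rw [T _ _ eVf, T _ _ eVfp]
    have := liftr ε (π/2 - α) (π/2 + α) (25/3) hε Vf Vfp cVf cVfp (fun x hx => by
      refine ang2 α hα hα' _ _ (S _ cVf x) (S _ cVfp x) (fun y hy => ?_) ?_ ?_
      · have hy' := Ioo_subset_Icc_self hy
        rw [eVfp x hx y hy']
        exact derivExt _ _ _ _ _ _ hy (eVf x hx) (hdvf x hx y hy')
      · rw [eVf x hx _ (left_mem_Icc.2 hab)]; exact (hbf x hx).1
      · rw [eVf x hx _ (right_mem_Icc.2 hab)]; exact (hbf x hx).2)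
    nlinarith
  · rw [T _ _ eVt]
    have e2 : (∫ ρ in ε..1, ∫ φ in (π/2 - α)..(π/2 + α),
          (vtr ρ φ ^ 2 + (vtp ρ φ / ρ) ^ 2) * (2*π*ρ^2*Real.sin φ)) =
        2 * π * ∫ ρ in ε..1, ∫ φ in (π/2 - α)..(π/2 + α),
          sin φ * (ρ ^ 2 * Vtr ρ φ ^ 2 + Vtp ρ φ ^ 2) := by
      apply dcong _ _ _ hε hab
      intro x hx y hy
      have hx0 : 0 < x := lt_of_lt_of_le hε0 hx.1
      rw [eVtr x hx y hy, eVtp x hx y hy]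
      field_simp
    have e3 : (∫ ρ in ε..1, ∫ φ in (π/2 - α)..(π/2 + α),
        (ρ * Real.sin φ * vt ρ φ) * (2*π*ρ^2*Real.sin φ)) =
        2 * π * ∫ ρ in ε..1, ∫ φ in (π/2 - α)..(π/2 + α),
          (1 / 4) * (sin φ ^ 2 * (4 * ρ ^ 3 * Vt ρ φ)) := by
      apply dcong _ _ _ hε hab
      intro x hx y hy
      rw [eVt x hx y hy]
      ring
    rw [hmt] at e3
    simp only [intervalIntegral.integral_const_mul (1 / 4 : ℝ)] at e3
    rw [e2]
    have := hardy3 ε α hε0 hε' hα hα' Vt Vtr Vtp cVt cVtr cVtp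
      (fun x hx y hy => by
        have hx' := Ioo_subset_Icc_self hx
        rw [eVtr x hx' y hy]
        exact derivExt _ _ _ _ _ _ hx (fun s hs => eVt s hs y hy) (hdvtr x hx' y hy))
      (fun x hx y hy => by
        have hy' := Ioo_subset_Icc_self hy
        rw [eVtp x hx y hy']
        exact derivExt _ _ _ _ _ _ hy (eVt x hx) (hdvtp x hx y hy'))
      (by
        have h2 : (2 * π) * (1 / 4) ≠ 0 := by positivity
        rw [← mul_assoc] at e3
        exact (mul_eq_zero.1 e3.symm).resolve_left h2)
    nlinarith
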